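/- Let n ≥ 2. Fix C > 0 and β with n/2 < β < n. Then there exists ε_0 > 0, depending only on C, β and n, with the following property: whenever n − ε_0 < α < n, E ⊆ ℝ^n is a closed set of Lebesgue measure zero supporting a probability measure μ satisfying μ(B(x,r)) ≤ C r^α for all x ∈ E and 0 < r < 1, and |μ̂(ξ)| ≤ C(1+|ξ|)^{−β/2} for all ξ ∈ ℝ^n, then there exist x, y, z ∈ ℝ^n with y ≠ 0, z ≠ 0, y ≠ z and y ≠ −z such that the four distinct points x, x+y, x+z, x+y+z all belong to E (a non-degenerate parallelogram in E). -/

import Mathlib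

open MeasureTheory

/-- The Fourier transform `μ̂(ξ) = ∫ e^{−2πi x·ξ} dμ(x)` of a measure on `ℝⁿ`. -/
noncomputable def fourierMeasure {n : ℕ} (μ : Measure (EuclideanSpace ℝ (Fin n)))
    (ξ : EuclideanSpace ℝ (Fin n)) : ℂ :=
  ∫ x, Complex.exp ((((-(2 * Real.pi * ∑ i, x i * ξ i)) : ℝ) : ℂ) * Complex.I) ∂μ

section
open Complex Module
open scoped RealInnerProductSpace ENNReal

variable {V : Type*} [NormedAddCommGroup V] [InnerProductSpace ℝ V] [FiniteDimensional ℝ V]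
  [MeasurableSpace V] [BorelSpace V]

theorem rexp_neg_sq_norm_eq_integral {b : ℝ} (hb : 0 < b) (w : V) :
    ((Real.exp (-(‖w‖ ^ 2 / (4 * b))) : ℝ) : ℂ) =
      (((b / Real.pi) ^ ((finrank ℝ V : ℝ) / 2) : ℝ) : ℂ) *
        ∫ v : V, ((Real.exp (-b * ‖v‖ ^ 2) : ℝ) : ℂ) * cexp (⟪w, v⟫ * I) := by
  have h := GaussianFourier.integral_cexp_neg_mul_sq_norm_add (V := V) (b := (b : ℂ))
    (by simpa using hb) I w
  have h1 : ∀ v : V, ((Real.exp (-b * ‖v‖ ^ 2) : ℝ) : ℂ) * cexp (⟪w, v⟫ * I) =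
      cexp (-b * ‖v‖ ^ 2 + I * ⟪w, v⟫) := fun v => by
    rw [Complex.exp_add]; push_cast; ring_nf
  have h2 : ((Real.pi : ℂ) / b) ^ ((finrank ℝ V : ℂ) / 2) =
      (((Real.pi / b) ^ ((finrank ℝ V : ℝ) / 2) : ℝ) : ℂ) := by
    rw [Complex.ofReal_cpow (by positivity)]; push_cast; rfl
  simp_rw [h1]
  rw [h, h2, ← mul_assoc, ← Complex.ofReal_mul, ← Real.mul_rpow (by positivity) (by positivity)]
  have : b / Real.pi * (Real.pi / b) = 1 := by field_simp
  rw [this, Real.one_rpow]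
  push_cast
  rw [I_sq]; ring_nf

theorem integrable_rexp_neg_mul_sq_norm {b : ℝ} (hb : 0 < b) :
    Integrable (fun v : V => Real.exp (-b * ‖v‖ ^ 2)) := by
  have h := (GaussianFourier.integrable_cexp_neg_mul_sq_norm_add (V := V) (b := (b : ℂ))
    (by simpa using hb) 0 0).norm
  refine h.congr (Filter.Eventually.of_forall fun v => ?_)
  simp [Complex.norm_exp, ← Complex.ofReal_pow]

theorem integral_char_mul_gaussian (ν : Measure V) [IsFiniteMeasure ν] {b : ℝ} (hb : 0 < b)
    (q₀ s : V) :
    ∫ q, cexp (⟪q, s⟫ * I) * ((Real.exp (-(‖q - q₀‖ ^ 2 / (4 * b))) : ℝ) : ℂ) ∂ν =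
      (((b / Real.pi) ^ ((finrank ℝ V : ℝ) / 2) : ℝ) : ℂ) *
        ∫ v : V, ((Real.exp (-b * ‖v‖ ^ 2) : ℝ) : ℂ) * cexp (-(⟪q₀, v⟫ * I)) *
          charFun ν (s + v) := by
  have key : ∀ q v : V, cexp (⟪q, s⟫ * I) *
      (((Real.exp (-b * ‖v‖ ^ 2) : ℝ) : ℂ) * cexp (⟪q - q₀, v⟫ * I)) =
      ((Real.exp (-b * ‖v‖ ^ 2) : ℝ) : ℂ) * cexp (-(⟪q₀, v⟫ * I)) * cexp (⟪q, s + v⟫ * I) := by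
    intro q v
    rw [inner_sub_left, inner_add_right, mul_left_comm, mul_assoc, ← Complex.exp_add,
      ← Complex.exp_add]
    push_cast; ring_nf
  simp_rw [rexp_neg_sq_norm_eq_integral hb, charFun_apply,
    mul_left_comm (cexp _) (Complex.ofReal _),
    ← integral_const_mul, key]
  rw [integral_integral_swap]
  have hg : Integrable (fun z : V × V => (b / Real.pi) ^ ((finrank ℝ V : ℝ) / 2) *
      Real.exp (-b * ‖z.2‖ ^ 2)) (ν.prod volume) :=
    ((integrable_rexp_neg_mul_sq_norm hb).const_mul _).comp_snd ν
  refine hg.mono' (by fun_prop) (Filter.Eventually.of_forall fun z => ?_)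
  have hc : 0 ≤ (b / Real.pi) ^ ((finrank ℝ V : ℝ) / 2) := by positivity
  simp [Function.uncurry, Complex.norm_exp, Complex.norm_real, abs_of_nonneg hc,
    -Complex.ofReal_pow]

theorem lintegral_gaussian_prod_le (ν : Measure V) [IsFiniteMeasure ν] {a b : ℝ} (ha : 0 < a)
    (hb : 0 < b) :
    ∫⁻ q, ∫⁻ p, ENNReal.ofReal (Real.exp (-(‖p - q‖ ^ 2 / (4 * a))) *
        Real.exp (-(‖q‖ ^ 2 / (4 * b)))) ∂ν ∂ν ≤
      ENNReal.ofReal ((a / Real.pi) ^ ((finrank ℝ V : ℝ) / 2)) *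
      ENNReal.ofReal ((b / Real.pi) ^ ((finrank ℝ V : ℝ) / 2)) *
        ∫⁻ v : V, ∫⁻ w : V, ENNReal.ofReal (Real.exp (-b * ‖v‖ ^ 2)) *
          (‖charFun ν w‖ₑ * ‖charFun ν (-w + v)‖ₑ) := by
  set A : ℝ := (a / Real.pi) ^ ((finrank ℝ V : ℝ) / 2)
  set B : ℝ := (b / Real.pi) ^ ((finrank ℝ V : ℝ) / 2)
  have hA : 0 ≤ A := by positivity
  have hB : 0 ≤ B := by positivity
  have hint : ∀ q : V, Integrable (fun p => Real.exp (-(‖p - q‖ ^ 2 / (4 * a))) *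
        Real.exp (-(‖q‖ ^ 2 / (4 * b)))) ν := fun q => by
    refine (integrable_const (1 : ℝ)).mono' (by fun_prop) (Filter.Eventually.of_forall fun z => ?_)
    rw [Real.norm_of_nonneg (by positivity)]
    refine mul_le_one₀ (Real.exp_le_one_iff.2 ?_) (by positivity) (Real.exp_le_one_iff.2 ?_) <;>
    · rw [neg_nonpos]; positivity
  have hint2 : Integrable (fun q => ∫ p, Real.exp (-(‖p - q‖ ^ 2 / (4 * a))) *
        Real.exp (-(‖q‖ ^ 2 / (4 * b))) ∂ν) ν := by
    have : Integrable (fun z : V × V => Real.exp (-(‖z.2 - z.1‖ ^ 2 / (4 * a))) *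
        Real.exp (-(‖z.1‖ ^ 2 / (4 * b)))) (ν.prod ν) := by
      refine (integrable_const (1 : ℝ)).mono' (by fun_prop)
        (Filter.Eventually.of_forall fun z => ?_)
      rw [Real.norm_of_nonneg (by positivity)]
      refine mul_le_one₀ (Real.exp_le_one_iff.2 ?_) (by positivity) (Real.exp_le_one_iff.2 ?_) <;>
      · rw [neg_nonpos]; positivity
    exact this.integral_prod_left
  have e1 : ∀ q : V, ∫⁻ p, ENNReal.ofReal (Real.exp (-(‖p - q‖ ^ 2 / (4 * a))) *
        Real.exp (-(‖q‖ ^ 2 / (4 * b)))) ∂ν =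
        ENNReal.ofReal (∫ p, Real.exp (-(‖p - q‖ ^ 2 / (4 * a))) *
        Real.exp (-(‖q‖ ^ 2 / (4 * b))) ∂ν) := fun q =>
    (ofReal_integral_eq_lintegral_ofReal (hint q)
      (Filter.Eventually.of_forall fun p => by positivity)).symm
  simp_rw [e1]
  rw [← ofReal_integral_eq_lintegral_ofReal hint2
    (Filter.Eventually.of_forall fun q => integral_nonneg fun p => by positivity)]
  have e2 : ((∫ q, ∫ p, Real.exp (-(‖p - q‖ ^ 2 / (4 * a))) *
        Real.exp (-(‖q‖ ^ 2 / (4 * b))) ∂ν ∂ν : ℝ) : ℂ) =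
      (A : ℂ) * ∫ w : V, ((Real.exp (-a * ‖w‖ ^ 2) : ℝ) : ℂ) * charFun ν w *
        ((B : ℂ) * ∫ v : V, ((Real.exp (-b * ‖v‖ ^ 2) : ℝ) : ℂ) * charFun ν (-w + v)) := by
    have h1 : ∀ q : V, ((∫ p, Real.exp (-(‖p - q‖ ^ 2 / (4 * a))) *
        Real.exp (-(‖q‖ ^ 2 / (4 * b))) ∂ν : ℝ) : ℂ) =
        (A : ℂ) * ∫ w : V, ((Real.exp (-a * ‖w‖ ^ 2) : ℝ) : ℂ) * charFun ν w *
          (cexp (⟪q, -w⟫ * I) * ((Real.exp (-(‖q‖ ^ 2 / (4 * b))) : ℝ) : ℂ)) := fun q => by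
      have := integral_char_mul_gaussian ν ha q 0
      simp only [inner_zero_right, ofReal_zero, zero_mul, Complex.exp_zero, one_mul,
        zero_add] at this
      rw [integral_mul_const, ofReal_mul, ← integral_complex_ofReal, this, mul_assoc,
        ← integral_mul_const]
      congr 1
      refine integral_congr_ae (Filter.Eventually.of_forall fun w => ?_)
      simp only [inner_neg_right, ofReal_neg, neg_mul]
      ring
    rw [← integral_complex_ofReal]
    simp_rw [h1]
    rw [integral_const_mul, integral_integral_swap]
    · congr 1
      refine integral_congr_ae (Filter.Eventually.of_forall fun w => ?_)
      have := integral_char_mul_gaussian ν hb 0 (-w)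
      simp only [inner_zero_left, ofReal_zero, zero_mul, neg_zero, Complex.exp_zero, mul_one,
        sub_zero] at this
      simp only
      rw [integral_const_mul, this]
    · have hg : Integrable (fun z : V × V => Real.exp (-a * ‖z.2‖ ^ 2) * ν.real Set.univ)
          (ν.prod volume) :=
        ((integrable_rexp_neg_mul_sq_norm ha).mul_const _).comp_snd ν
      refine hg.mono' (by fun_prop) (Filter.Eventually.of_forall fun z => ?_)
      simp only [Function.uncurry, norm_mul, Complex.norm_real, Complex.norm_exp]
      simp only [Real.norm_eq_abs, Real.abs_exp, mul_re, ofReal_re, I_re, ofReal_im, I_im, mul_zero,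
        zero_mul, sub_zero, Real.exp_zero, one_mul]
      have : Real.exp (-(‖z.1‖ ^ 2 / (4 * b))) ≤ 1 :=
        Real.exp_le_one_iff.2 (by rw [neg_nonpos]; positivity)
      have h2 := norm_charFun_le (μ := ν) z.2
      calc _ ≤ Real.exp (-a * ‖z.2‖ ^ 2) * ν.real Set.univ * 1 := by gcongr
        _ = _ := mul_one _
  have hJ : 0 ≤ ∫ q, ∫ p, Real.exp (-(‖p - q‖ ^ 2 / (4 * a))) *
        Real.exp (-(‖q‖ ^ 2 / (4 * b))) ∂ν ∂ν :=
    integral_nonneg fun q => integral_nonneg fun p => by positivity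
  rw [← Real.enorm_of_nonneg hJ, ← Real.enorm_of_nonneg hA, ← Real.enorm_of_nonneg hB]
  have eR : ∀ x : ℝ, ‖x‖ₑ = ‖(x : ℂ)‖ₑ := fun x => by
    rw [← ofReal_norm, ← ofReal_norm, Complex.norm_real]
  rw [eR, e2, enorm_mul, ← eR, mul_assoc]
  gcongr
  have hm := measurable_charFun (μ := ν)
  rw [lintegral_lintegral_swap (by fun_prop), ← lintegral_const_mul' _ _ (by simp)]
  refine (enorm_integral_le_lintegral_enorm _).trans (lintegral_mono fun w => ?_)
  rw [enorm_mul, enorm_mul, enorm_mul, ← eR, ← eR]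
  have hE : ‖Real.exp (-a * ‖w‖ ^ 2)‖ₑ ≤ 1 := by
    rw [Real.enorm_of_nonneg (by positivity)]
    refine ENNReal.ofReal_le_one.2 (Real.exp_le_one_iff.2 ?_)
    rw [neg_mul, neg_nonpos]; positivity
  calc _ ≤ 1 * ‖charFun ν w‖ₑ * (‖B‖ₑ * ∫⁻ v : V, ‖((Real.exp (-b * ‖v‖ ^ 2) : ℝ) : ℂ) *
        charFun ν (-w + v)‖ₑ) := by
        gcongr
        exact enorm_integral_le_lintegral_enorm _
    _ = ‖B‖ₑ * (‖charFun ν w‖ₑ * ∫⁻ v : V, ‖((Real.exp (-b * ‖v‖ ^ 2) : ℝ) : ℂ) *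
        charFun ν (-w + v)‖ₑ) := by ring
    _ ≤ _ := by
        rw [← lintegral_const_mul' _ _ (by simp)]
        gcongr ‖B‖ₑ * ?_
        refine lintegral_mono fun v => ?_
        rw [enorm_mul, ← eR, Real.enorm_of_nonneg (by positivity)]
        exact le_of_eq (by ring)

theorem lintegral_gaussian_mul_charFun_le (ν : Measure V) [IsFiniteMeasure ν] {D s γ : ℝ}
    (hs : 0 ≤ s) (hφ : ∀ ξ : V, ‖charFun ν ξ‖ ≤ D * (1 + ‖ξ‖) ^ (-(s + γ))) (b : ℝ) :
    ∫⁻ v : V, ∫⁻ w : V, ENNReal.ofReal (Real.exp (-b * ‖v‖ ^ 2)) *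
          (‖charFun ν w‖ₑ * ‖charFun ν (-w + v)‖ₑ) ≤
      ENNReal.ofReal (D ^ 2) * (∫⁻ w : V, ENNReal.ofReal ((1 + ‖w‖) ^ (-(2 * γ)))) *
        ∫⁻ v : V, ENNReal.ofReal (Real.exp (-b * ‖v‖ ^ 2) * (1 + ‖v‖) ^ (-s)) := by
  have hpt : ∀ v w : V, ENNReal.ofReal (Real.exp (-b * ‖v‖ ^ 2)) *
      (‖charFun ν w‖ₑ * ‖charFun ν (-w + v)‖ₑ) ≤
      ENNReal.ofReal (D ^ 2 * (Real.exp (-b * ‖v‖ ^ 2) * (1 + ‖v‖) ^ (-s)) * 2⁻¹) *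
        (ENNReal.ofReal ((1 + ‖w‖) ^ (-(2 * γ))) +
          ENNReal.ofReal ((1 + ‖-w + v‖) ^ (-(2 * γ)))) := by
    intro v w
    rw [← ofReal_norm, ← ofReal_norm, ← ENNReal.ofReal_mul (by positivity),
      ← ENNReal.ofReal_mul (by positivity), ← ENNReal.ofReal_add (by positivity) (by positivity),
      ← ENNReal.ofReal_mul (by positivity)]
    refine ENNReal.ofReal_le_ofReal ?_
    have hx : 0 < 1 + ‖w‖ := by positivity
    have hy : 0 < 1 + ‖-w + v‖ := by positivity
    have hz : 0 < 1 + ‖v‖ := by positivity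
    have hxy : 1 + ‖v‖ ≤ (1 + ‖w‖) * (1 + ‖-w + v‖) := by
      have : ‖v‖ ≤ ‖w‖ + ‖-w + v‖ := by simpa using norm_add_le w (-w + v)
      nlinarith [norm_nonneg w, norm_nonneg (-w + v)]
    have h1 : ((1 + ‖w‖) * (1 + ‖-w + v‖)) ^ (-s) ≤ (1 + ‖v‖) ^ (-s) :=
      Real.rpow_le_rpow_of_nonpos hz hxy (by linarith)
    have h2 : ‖charFun ν w‖ * ‖charFun ν (-w + v)‖ ≤
        D ^ 2 * ((1 + ‖v‖) ^ (-s) * ((1 + ‖w‖) ^ (-γ) * (1 + ‖-w + v‖) ^ (-γ))) :=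
      calc _ ≤ (D * (1 + ‖w‖) ^ (-(s + γ))) * (D * (1 + ‖-w + v‖) ^ (-(s + γ))) :=
            mul_le_mul (hφ _) (hφ _) (norm_nonneg _) ((norm_nonneg _).trans (hφ _))
        _ = D ^ 2 * (((1 + ‖w‖) * (1 + ‖-w + v‖)) ^ (-s) *
              ((1 + ‖w‖) ^ (-γ) * (1 + ‖-w + v‖) ^ (-γ))) := by
            rw [neg_add, Real.rpow_add hx, Real.rpow_add hy, Real.mul_rpow hx.le hy.le]; ring
        _ ≤ _ := by gcongr
    have h3 : ∀ t : ℝ, 0 < t → t ^ (-(2 * γ)) = (t ^ (-γ)) ^ 2 := fun t ht => by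
      rw [← Real.rpow_natCast, ← Real.rpow_mul ht.le]; congr 1; push_cast; ring
    rw [h3 _ hx, h3 _ hy]
    have h4 : (1 + ‖w‖) ^ (-γ) * (1 + ‖-w + v‖) ^ (-γ) ≤
        2⁻¹ * (((1 + ‖w‖) ^ (-γ)) ^ 2 + ((1 + ‖-w + v‖) ^ (-γ)) ^ 2) := by
      nlinarith [sq_nonneg ((1 + ‖w‖) ^ (-γ) - (1 + ‖-w + v‖) ^ (-γ))]
    calc _ ≤ Real.exp (-b * ‖v‖ ^ 2) * (D ^ 2 * ((1 + ‖v‖) ^ (-s) *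
          (2⁻¹ * (((1 + ‖w‖) ^ (-γ)) ^ 2 + ((1 + ‖-w + v‖) ^ (-γ)) ^ 2)))) := by
          refine mul_le_mul_of_nonneg_left (h2.trans ?_) (by positivity)
          gcongr
      _ = _ := by ring
  refine (lintegral_mono fun v => lintegral_mono fun w => hpt v w).trans (le_of_eq ?_)
  rw [← lintegral_const_mul _ (by fun_prop)]
  refine lintegral_congr fun v => ?_
  rw [lintegral_const_mul _ (by fun_prop), lintegral_add_left (by fun_prop)]
  have hI : ∫⁻ w : V, ENNReal.ofReal ((1 + ‖-w + v‖) ^ (-(2 * γ))) =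
      ∫⁻ w : V, ENNReal.ofReal ((1 + ‖w‖) ^ (-(2 * γ))) := by
    have := lintegral_sub_left_eq_self (μ := (volume : Measure V))
      (fun w : V => ENNReal.ofReal ((1 + ‖w‖) ^ (-(2 * γ)))) v
    rw [← this]
    refine lintegral_congr fun w => ?_
    rw [neg_add_eq_sub]
  rw [hI, ENNReal.ofReal_mul (by positivity), ENNReal.ofReal_mul (by positivity), ← two_mul]
  have h2 : ENNReal.ofReal 2⁻¹ * 2 = 1 := by
    rw [ENNReal.ofReal_inv_of_pos (by norm_num), ENNReal.ofReal_ofNat]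
    exact ENNReal.inv_mul_cancel (by simp) (by simp)
  calc _ = ENNReal.ofReal (D ^ 2) * ENNReal.ofReal (Real.exp (-b * ‖v‖ ^ 2) * (1 + ‖v‖) ^ (-s)) *
      (ENNReal.ofReal 2⁻¹ * 2) * ∫⁻ w : V, ENNReal.ofReal ((1 + ‖w‖) ^ (-(2 * γ))) := by ring
    _ = _ := by rw [h2]; ring

theorem exists_gaussian_average_le [Nontrivial V] {s : ℝ} (hs : 0 < s) {δ : ℝ≥0∞} (hδ : δ ≠ 0) :
    ∃ b > (0 : ℝ), ENNReal.ofReal ((b / Real.pi) ^ ((finrank ℝ V : ℝ) / 2)) *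
      ∫⁻ v : V, ENNReal.ofReal (Real.exp (-b * ‖v‖ ^ 2) * (1 + ‖v‖) ^ (-s)) ≤ δ := by
  have hδ2 : δ / 2 ≠ 0 := by simpa using hδ
  obtain ⟨δ', hδ'0, hδ'⟩ : ∃ δ' : ℝ, 0 < δ' ∧ ENNReal.ofReal δ' ≤ δ / 2 := by
    obtain ⟨r, hr0, hr⟩ := ENNReal.lt_iff_exists_nnreal_btwn.1 (pos_iff_ne_zero.2 hδ2)
    exact ⟨r, by exact_mod_cast hr0, by simpa using hr.le⟩
  obtain ⟨R, hR⟩ : ∃ R : ℝ, ∀ t ≥ R, (1 + t) ^ (-s) ≤ δ' := by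
    have : Filter.Tendsto (fun t : ℝ => (1 + t) ^ (-s)) Filter.atTop (nhds 0) :=
      (tendsto_rpow_neg_atTop hs).comp (Filter.tendsto_atTop_add_const_left _ 1 Filter.tendsto_id)
    exact Filter.eventually_atTop.1 ((this.eventually_lt_const hδ'0).mono fun _ h => h.le)
  have hn : (0 : ℝ) < (finrank ℝ V : ℝ) / 2 := by
    have := finrank_pos (R := ℝ) (M := V)
    positivity
  obtain ⟨b, hb0, hb⟩ : ∃ b > (0 : ℝ),
      ENNReal.ofReal ((b / Real.pi) ^ ((finrank ℝ V : ℝ) / 2)) *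
        volume (Metric.ball (0 : V) R) ≤ δ / 2 := by
    have h1 : Filter.Tendsto (fun b : ℝ => ENNReal.ofReal
        ((b / Real.pi) ^ ((finrank ℝ V : ℝ) / 2)) * volume (Metric.ball (0 : V) R))
        (nhds 0) (nhds 0) := by
      have h2 : Filter.Tendsto (fun b : ℝ => (b / Real.pi) ^ ((finrank ℝ V : ℝ) / 2))
          (nhds 0) (nhds 0) := by
        have : ContinuousAt (fun b : ℝ => (b / Real.pi) ^ ((finrank ℝ V : ℝ) / 2)) 0 :=
          (continuousAt_id.div_const _).rpow_const (Or.inr hn.le)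
        simpa [ContinuousAt, Real.zero_rpow hn.ne'] using this
      have h3 := ENNReal.Tendsto.mul_const (b := volume (Metric.ball (0 : V) R))
        (ENNReal.tendsto_ofReal h2) (Or.inr measure_ball_lt_top.ne)
      simpa using h3
    have h4 : ∀ᶠ b in nhdsWithin (0 : ℝ) (Set.Ioi 0), ENNReal.ofReal
        ((b / Real.pi) ^ ((finrank ℝ V : ℝ) / 2)) * volume (Metric.ball (0 : V) R) ≤ δ / 2 :=
      ((h1.mono_left nhdsWithin_le_nhds).eventually_lt_const
        (pos_iff_ne_zero.2 hδ2)).mono fun _ h => h.le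
    obtain ⟨b, h5, h6⟩ := (h4.and self_mem_nhdsWithin).exists
    exact ⟨b, h6, h5⟩
  refine ⟨b, hb0, ?_⟩
  set c := (b / Real.pi) ^ ((finrank ℝ V : ℝ) / 2) with hc
  have hc0 : 0 ≤ c := by positivity
  have hG : ENNReal.ofReal c * ∫⁻ v : V, ENNReal.ofReal (Real.exp (-b * ‖v‖ ^ 2)) = 1 := by
    rw [← ofReal_integral_eq_lintegral_ofReal (integrable_rexp_neg_mul_sq_norm hb0)
      (Filter.Eventually.of_forall fun _ => by positivity),
      GaussianFourier.integral_rexp_neg_mul_sq_norm hb0, ← ENNReal.ofReal_mul hc0, hc,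
      ← Real.mul_rpow (by positivity) (by positivity)]
    have : b / Real.pi * (Real.pi / b) = 1 := by field_simp
    rw [this, Real.one_rpow, ENNReal.ofReal_one]
  have hpt : ∀ v : V, ENNReal.ofReal (Real.exp (-b * ‖v‖ ^ 2) * (1 + ‖v‖) ^ (-s)) ≤
      ENNReal.ofReal (Real.exp (-b * ‖v‖ ^ 2)) * ENNReal.ofReal δ' +
        (Metric.ball (0 : V) R).indicator 1 v := by
    intro v
    by_cases hv : v ∈ Metric.ball (0 : V) R
    · rw [Set.indicator_of_mem hv]
      refine le_add_of_nonneg_of_le zero_le ?_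
      refine ENNReal.ofReal_le_one.2 (mul_le_one₀ (Real.exp_le_one_iff.2 ?_) (by positivity) ?_)
      · rw [neg_mul, neg_nonpos]; positivity
      · exact Real.rpow_le_one_of_one_le_of_nonpos (by linarith [norm_nonneg v]) (by linarith)
    · rw [Set.indicator_of_notMem hv, add_zero, ← ENNReal.ofReal_mul (by positivity)]
      gcongr
      exact hR _ (by simpa using hv)
  calc _ ≤ ENNReal.ofReal c * ∫⁻ v : V, (ENNReal.ofReal (Real.exp (-b * ‖v‖ ^ 2)) *
        ENNReal.ofReal δ' + (Metric.ball (0 : V) R).indicator 1 v) := by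
        gcongr with v; exact hpt v
    _ = (ENNReal.ofReal c * ∫⁻ v : V, ENNReal.ofReal (Real.exp (-b * ‖v‖ ^ 2))) *
        ENNReal.ofReal δ' + ENNReal.ofReal c * volume (Metric.ball (0 : V) R) := by
        rw [lintegral_add_left (by fun_prop), lintegral_mul_const _ (by fun_prop),
          lintegral_indicator_one measurableSet_ball]
        ring
    _ ≤ δ / 2 + δ / 2 := by rw [hG, one_mul]; gcongr
    _ = δ := ENNReal.add_halves δ

theorem exists_measure_prod_near_diag_le [Nontrivial V] (ν : Measure V) [IsFiniteMeasure ν]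
    {D β : ℝ} (hβ : (finrank ℝ V : ℝ) / 2 < β)
    (hφ : ∀ ξ : V, ‖charFun ν ξ‖ ≤ D * (1 + ‖ξ‖) ^ (-β)) {δ : ℝ≥0∞} (hδ : δ ≠ 0) :
    ∃ d > (0 : ℝ), ∀ ε > (0 : ℝ),
      (ν.prod ν) {z | ‖z.2 - z.1‖ < ε ∧ ‖z.1‖ < d} ≤
        δ * ENNReal.ofReal (ε ^ finrank ℝ V) := by
  obtain ⟨γ, hγ1, hγ2⟩ := exists_between hβ
  set M : ℝ≥0∞ := 4 * (ENNReal.ofReal (D ^ 2) *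
    ∫⁻ w : V, ENNReal.ofReal ((1 + ‖w‖) ^ (-(2 * γ)))) with hM
  have hMtop : M ≠ ⊤ := by
    have := finite_integral_one_add_norm (μ := (volume : Measure V)) (r := 2 * γ) (by linarith)
    exact ENNReal.mul_ne_top (by simp) (ENNReal.mul_ne_top (by simp) this.ne)
  have hδM : δ / M ≠ 0 := by simp [ENNReal.div_eq_zero_iff, hδ, hMtop]
  obtain ⟨b, hb0, hb⟩ := exists_gaussian_average_le (V := V) (sub_pos.2 hγ2) hδM
  refine ⟨√b, Real.sqrt_pos.2 hb0, fun ε hε => ?_⟩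
  have hpt : ∀ z : V × V, {z : V × V | ‖z.2 - z.1‖ < ε ∧ ‖z.1‖ < √b}.indicator 1 z ≤
      4 * ENNReal.ofReal (Real.exp (-(‖z.2 - z.1‖ ^ 2 / (4 * ε ^ 2))) *
        Real.exp (-(‖z.1‖ ^ 2 / (4 * b)))) := by
    intro z
    by_cases hz : z ∈ {z : V × V | ‖z.2 - z.1‖ < ε ∧ ‖z.1‖ < √b}
    swap
    · rw [Set.indicator_of_notMem hz]; exact zero_le
    rw [Set.indicator_of_mem hz]
    obtain ⟨h1, h2⟩ := hz
    have h3 : ‖z.2 - z.1‖ ^ 2 / (4 * ε ^ 2) ≤ 1 / 4 := by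
      rw [div_le_div_iff₀ (by positivity) (by norm_num)]
      nlinarith [norm_nonneg (z.2 - z.1)]
    have h4 : ‖z.1‖ ^ 2 / (4 * b) ≤ 1 / 4 := by
      rw [div_le_div_iff₀ (by positivity) (by norm_num)]
      have := (Real.lt_sqrt (norm_nonneg _)).1 h2
      nlinarith
    rw [← Real.exp_add, show (4 : ℝ≥0∞) = ENNReal.ofReal 4 by simp,
      ← ENNReal.ofReal_mul (by norm_num), Pi.one_apply, ← ENNReal.ofReal_one]
    refine ENNReal.ofReal_le_ofReal ?_
    nlinarith [Real.add_one_le_exp (-(‖z.2 - z.1‖ ^ 2 / (4 * ε ^ 2)) + -(‖z.1‖ ^ 2 / (4 * b)))]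
  have hms : MeasurableSet {z : V × V | ‖z.2 - z.1‖ < ε ∧ ‖z.1‖ < √b} :=
    MeasurableSet.inter
      (measurableSet_lt (f := fun z : V × V => ‖z.2 - z.1‖) (by fun_prop) measurable_const)
      (measurableSet_lt (f := fun z : V × V => ‖z.1‖) (by fun_prop) measurable_const)
  have hA : ENNReal.ofReal ((ε ^ 2 / Real.pi) ^ ((finrank ℝ V : ℝ) / 2)) ≤
      ENNReal.ofReal (ε ^ finrank ℝ V) := by
    refine ENNReal.ofReal_le_ofReal ?_
    calc (ε ^ 2 / Real.pi) ^ ((finrank ℝ V : ℝ) / 2) ≤ (ε ^ 2) ^ ((finrank ℝ V : ℝ) / 2) := by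
          gcongr
          exact div_le_self (by positivity) (by linarith [Real.pi_gt_three])
      _ = ε ^ finrank ℝ V := by
          rw [← Real.rpow_natCast, ← Real.rpow_mul hε.le, ← Real.rpow_natCast]
          congr 1; push_cast; ring
  calc (ν.prod ν) {z | ‖z.2 - z.1‖ < ε ∧ ‖z.1‖ < √b}
      = ∫⁻ z, {z : V × V | ‖z.2 - z.1‖ < ε ∧ ‖z.1‖ < √b}.indicator 1 z ∂(ν.prod ν) :=
        (lintegral_indicator_one hms).symm
    _ ≤ ∫⁻ z, 4 * ENNReal.ofReal (Real.exp (-(‖z.2 - z.1‖ ^ 2 / (4 * ε ^ 2))) *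
        Real.exp (-(‖z.1‖ ^ 2 / (4 * b)))) ∂(ν.prod ν) := lintegral_mono hpt
    _ = 4 * ∫⁻ q, ∫⁻ p, ENNReal.ofReal (Real.exp (-(‖p - q‖ ^ 2 / (4 * ε ^ 2))) *
        Real.exp (-(‖q‖ ^ 2 / (4 * b)))) ∂ν ∂ν := by
        rw [lintegral_const_mul _ (by fun_prop), lintegral_prod _ (by fun_prop)]
    _ ≤ 4 * (ENNReal.ofReal (ε ^ finrank ℝ V) *
      ENNReal.ofReal ((b / Real.pi) ^ ((finrank ℝ V : ℝ) / 2)) *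
        (ENNReal.ofReal (D ^ 2) * (∫⁻ w : V, ENNReal.ofReal ((1 + ‖w‖) ^ (-(2 * γ)))) *
        ∫⁻ v : V, ENNReal.ofReal (Real.exp (-b * ‖v‖ ^ 2) * (1 + ‖v‖) ^ (-(β - γ))))) := by
        gcongr
        refine (lintegral_gaussian_prod_le ν (by positivity) hb0).trans ?_
        gcongr
        exact lintegral_gaussian_mul_charFun_le ν (sub_pos.2 hγ2).le (by simpa using hφ) b
    _ = M * (ENNReal.ofReal ((b / Real.pi) ^ ((finrank ℝ V : ℝ) / 2)) *
        ∫⁻ v : V, ENNReal.ofReal (Real.exp (-b * ‖v‖ ^ 2) * (1 + ‖v‖) ^ (-(β - γ)))) *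
        ENNReal.ofReal (ε ^ finrank ℝ V) := by rw [hM]; ring
    _ ≤ M * (δ / M) * ENNReal.ofReal (ε ^ finrank ℝ V) := by gcongr
    _ ≤ _ := by gcongr; exact ENNReal.mul_div_le

theorem sq_lintegral_le {X : Type*} [MeasurableSpace X] {μ : Measure X} {f : X → ℝ≥0∞}
    (hf : AEMeasurable f μ) : (∫⁻ x, f x ∂μ) ^ 2 ≤ μ Set.univ * ∫⁻ x, f x ^ 2 ∂μ := by
  have h := ENNReal.lintegral_mul_le_Lp_mul_Lq μ (p := 2) (q := 2) (by
    constructor <;> norm_num) (aemeasurable_const (b := (1 : ℝ≥0∞))) hf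
  simp only [Pi.mul_apply, one_mul, one_pow, lintegral_const, ENNReal.rpow_ofNat] at h
  calc _ ≤ (μ Set.univ ^ (1 / 2 : ℝ) * (∫⁻ x, f x ^ 2 ∂μ) ^ (1 / 2 : ℝ)) ^ 2 := by gcongr
    _ = _ := by
      rw [mul_pow, ← ENNReal.rpow_natCast, ← ENNReal.rpow_natCast, ← ENNReal.rpow_mul,
        ← ENNReal.rpow_mul]
      norm_num

theorem sq_measure_mul_volume_ball_le (m : Measure V) [IsFiniteMeasure m] {c₀ : V} {R : ℝ}
    (hm : m (Metric.closedBall c₀ R)ᶜ = 0) {ε : ℝ} (hε : 0 < ε) (hε1 : ε ≤ 1) :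
    m Set.univ ^ 2 * volume (Metric.ball (0 : V) ε) ≤
      volume (Metric.ball c₀ (R + 1)) * (m.prod m) {z | ‖z.2 - z.1‖ < 2 * ε} := by
  set B := Metric.ball (0 : V) ε
  set χ : V → ℝ≥0∞ := B.indicator 1 with hχ
  have hχm : Measurable χ := measurable_one.indicator measurableSet_ball
  have hχB : ∀ u : V, ∫⁻ c, χ (u - c) = volume B := fun u => by
    rw [lintegral_sub_left_eq_self χ u, hχ, lintegral_indicator_one measurableSet_ball]
  have htot : ∫⁻ c, ∫⁻ u, χ (u - c) ∂m = m Set.univ * volume B := by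
    rw [lintegral_lintegral_swap (by fun_prop)]
    simp_rw [hχB]
    rw [lintegral_const, mul_comm]
  have hsupp : ∫⁻ c, ∫⁻ u, χ (u - c) ∂m =
      ∫⁻ c in Metric.ball c₀ (R + 1), ∫⁻ u, χ (u - c) ∂m := by
    rw [← lintegral_indicator measurableSet_ball]
    refine lintegral_congr fun c => ?_
    by_cases hc : c ∈ Metric.ball c₀ (R + 1)
    · rw [Set.indicator_of_mem hc]
    · rw [Set.indicator_of_notMem hc]
      refine (lintegral_eq_zero_iff (by fun_prop)).2 ?_
      have : ∀ᵐ u ∂m, u ∈ Metric.closedBall c₀ R := hm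
      filter_upwards [this] with u hu
      refine Set.indicator_of_notMem (fun h => hc ?_) _
      rw [mem_ball_zero_iff, ← dist_eq_norm] at h
      rw [Metric.mem_closedBall] at hu
      rw [Metric.mem_ball]
      linarith [dist_triangle c u c₀, dist_comm c u]
  have hms : MeasurableSet {z : V × V | ‖z.2 - z.1‖ < 2 * ε} :=
    measurableSet_lt (f := fun z : V × V => ‖z.2 - z.1‖) (by fun_prop) measurable_const
  have hpair : ∫⁻ c, (∫⁻ u, χ (u - c) ∂m) ^ 2 ≤
      volume B * (m.prod m) {z | ‖z.2 - z.1‖ < 2 * ε} := by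
    have h1 : ∀ c, (∫⁻ u, χ (u - c) ∂m) ^ 2 =
        ∫⁻ z, χ (z.1 - c) * χ (z.2 - c) ∂(m.prod m) := fun c => by
      rw [sq, lintegral_prod_mul (f := fun u => χ (u - c)) (g := fun u => χ (u - c))
        (by fun_prop) (by fun_prop)]
    simp_rw [h1]
    rw [lintegral_lintegral_swap (by fun_prop), ← lintegral_indicator_one hms,
      ← lintegral_const_mul _ (measurable_one.indicator hms)]
    refine lintegral_mono fun z => ?_
    by_cases hz : z ∈ {z : V × V | ‖z.2 - z.1‖ < 2 * ε}
    · rw [Set.indicator_of_mem hz, Pi.one_apply, mul_one, ← hχB z.1]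
      refine lintegral_mono fun c => ?_
      refine mul_le_of_le_one_right' ?_
      exact Set.indicator_le_self' (fun _ _ => zero_le) _
    · refine le_of_eq_of_le ?_ zero_le
      refine (lintegral_eq_zero_iff (by fun_prop)).2 (Filter.Eventually.of_forall fun c => ?_)
      simp only [Pi.zero_apply, mul_eq_zero]
      by_contra! h
      have h1 := Set.mem_of_indicator_ne_zero h.1
      have h2 := Set.mem_of_indicator_ne_zero h.2
      rw [mem_ball_zero_iff, ← dist_eq_norm] at h1 h2
      refine hz ?_
      rw [Set.mem_ofPred_eq, ← dist_eq_norm]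
      linarith [dist_triangle_right z.2 z.1 c]
  have hfin : volume B ≠ ⊤ := measure_ball_lt_top.ne
  have hpos : volume B ≠ 0 := (Metric.measure_ball_pos _ _ hε).ne'
  refine (ENNReal.mul_le_mul_iff_left hpos hfin).1 ?_
  calc m Set.univ ^ 2 * volume B * volume B = (m Set.univ * volume B) ^ 2 := by ring
    _ = (∫⁻ c in Metric.ball c₀ (R + 1), ∫⁻ u, χ (u - c) ∂m) ^ 2 := by rw [← hsupp, htot]
    _ ≤ volume (Metric.ball c₀ (R + 1)) *
        ∫⁻ c in Metric.ball c₀ (R + 1), (∫⁻ u, χ (u - c) ∂m) ^ 2 := by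
        refine (sq_lintegral_le (by fun_prop)).trans_eq ?_
        rw [Measure.restrict_apply_univ]
    _ ≤ volume (Metric.ball c₀ (R + 1)) * (volume B *
        (m.prod m) {z | ‖z.2 - z.1‖ < 2 * ε}) := by
        gcongr
        exact (setLIntegral_le_lintegral _ _).trans hpair
    _ = _ := by ring

theorem measurePreserving_prodProdProdComm {X : Type*} [MeasurableSpace X] (μ : Measure X)
    [SFinite μ] :
    MeasurePreserving (fun z : (X × X) × (X × X) => ((z.1.1, z.2.1), (z.1.2, z.2.2)))
      ((μ.prod μ).prod (μ.prod μ)) ((μ.prod μ).prod (μ.prod μ)) := by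
  have h : MeasurePreserving (fun z : X × (X × X) => (z.2.1, (z.1, z.2.2)))
      (μ.prod (μ.prod μ)) (μ.prod (μ.prod μ)) :=
    (measurePreserving_prodAssoc μ μ μ).comp
      (((Measure.measurePreserving_swap (μ := μ) (ν := μ)).prod (MeasurePreserving.id μ)).comp
        (measurePreserving_prodAssoc μ μ μ).symm)
  exact (measurePreserving_prodAssoc μ μ (μ.prod μ)).symm.comp
    (((MeasurePreserving.id μ).prod h).comp (measurePreserving_prodAssoc μ μ (μ.prod μ)))

theorem charFun_map_sub_prod (μ : Measure V) [IsFiniteMeasure μ] (t : V) :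
    charFun ((μ.prod μ).map fun z => z.1 - z.2) t = charFun μ t * charFun μ (-t) := by
  rw [charFun_apply, charFun_apply, charFun_apply, integral_map (by fun_prop) (by fun_prop),
    ← integral_prod_mul]
  refine integral_congr_ae (Filter.Eventually.of_forall fun z => ?_)
  simp only [inner_sub_left, inner_neg_right, ← Complex.exp_add]
  push_cast; ring_nf

theorem exists_parallelogram [Nontrivial V] {E : Set V} (hE : IsClosed E) (μ : Measure V)
    [IsProbabilityMeasure μ] (hμE : μ Eᶜ = 0) (hμ : ∀ x ∈ E, μ {x} = 0) {D β : ℝ}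
    (hβ : (finrank ℝ V : ℝ) / 2 < β)
    (hφ : ∀ ξ : V, ‖charFun μ ξ‖ ≤ D * (1 + ‖ξ‖) ^ (-(β / 2))) :
    ∃ x y z : V, y ≠ 0 ∧ z ≠ 0 ∧ y ≠ z ∧ y ≠ -z ∧
      x ∈ E ∧ x + y ∈ E ∧ x + z ∈ E ∧ x + y + z ∈ E := by
  have hae : ∀ᵐ x ∂μ, x ∈ E ∧ x ∈ μ.support := by
    have h1 : ∀ᵐ x ∂μ, x ∈ E := hμE
    exact h1.and Measure.support_mem_ae
  obtain ⟨a, haE, ha⟩ := hae.exists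
  have hne : ∀ᵐ x ∂μ, x ≠ a := by
    have := hμ a haE
    rwa [ae_iff, show {x | ¬x ≠ a} = {a} by ext; simp]
  obtain ⟨b, ⟨hbE, hb⟩, hba⟩ := (hae.and hne).exists
  set r := ‖b - a‖ / 5 with hr
  have hr0 : 0 < r := by
    have := norm_pos_iff.2 (sub_ne_zero.2 hba)
    positivity
  set A := E ∩ Metric.closedBall a r
  set B := E ∩ Metric.closedBall b r
  have hAc : IsCompact A := (isCompact_closedBall a r).inter_left hE
  have hBc : IsCompact B := (isCompact_closedBall b r).inter_left hE
  have hpos : ∀ x ∈ μ.support, μ (E ∩ Metric.closedBall x r) ≠ 0 := fun x hx => by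
    have h1 := (Measure.mem_support_iff_forall x).1 hx _ (Metric.closedBall_mem_nhds x hr0)
    rw [Set.inter_comm, measure_inter_conull hμE]
    exact h1.ne'
  have hA0 : μ A ≠ 0 := hpos a ha
  have hB0 : μ B ≠ 0 := hpos b hb
  by_contra hno
  have hdeg : ∀ x ∈ A, ∀ x' ∈ B, ∀ w ∈ A, ∀ w' ∈ B, x' - x = w' - w → x = w := by
    intro x hx x' hx' w hw w' hw' h
    by_contra hxw
    have h1 : ‖x - a‖ ≤ r := mem_closedBall_iff_norm.1 hx.2
    have h2 : ‖x' - b‖ ≤ r := mem_closedBall_iff_norm.1 hx'.2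
    have h3 : ‖w - a‖ ≤ r := mem_closedBall_iff_norm.1 hw.2
    have h5 : ‖b - a‖ = 5 * r := by rw [hr]; ring
    have hz : ‖w - x‖ ≤ 2 * r := by
      calc ‖w - x‖ = ‖(w - a) - (x - a)‖ := by congr 1; abel
        _ ≤ ‖w - a‖ + ‖x - a‖ := norm_sub_le _ _
        _ ≤ 2 * r := by linarith
    have hy : 3 * r ≤ ‖x' - x‖ := by
      have : ‖b - a‖ ≤ ‖x' - x‖ + ‖x - a‖ + ‖x' - b‖ := by
        calc ‖b - a‖ = ‖(x' - x) + (x - a) - (x' - b)‖ := by congr 1; abel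
          _ ≤ ‖(x' - x) + (x - a)‖ + ‖x' - b‖ := norm_sub_le _ _
          _ ≤ _ := by gcongr; exact norm_add_le _ _
      linarith
    refine hno ⟨x, x' - x, w - x, ?_, ?_, ?_, ?_, hx.1, ?_, ?_, ?_⟩
    · intro h0
      rw [h0, norm_zero] at hy
      linarith
    · exact sub_ne_zero.2 (Ne.symm hxw)
    · intro h0
      rw [h0] at hy
      linarith
    · intro h0
      rw [h0, norm_neg] at hy
      linarith
    · simpa using hx'.1
    · simpa using hw.1
    · have : x + (x' - x) + (w - x) = w' := by rw [h]; abel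
      rw [this]
      exact hw'.1
  have hsep : ∀ d > (0 : ℝ), ∃ η > (0 : ℝ), ∀ x ∈ A, ∀ x' ∈ B, ∀ w ∈ A, ∀ w' ∈ B,
      ‖(w' - w) - (x' - x)‖ < η → ‖x - w‖ < d := by
    intro d hd
    have hK : IsCompact (((A ×ˢ B) ×ˢ (A ×ˢ B)) ∩
        {z : (V × V) × (V × V) | d ≤ ‖z.1.1 - z.2.1‖}) :=
      ((hAc.prod hBc).prod (hAc.prod hBc)).inter_right
        (isClosed_le continuous_const (by fun_prop))
    obtain ⟨η, hη0, hη⟩ := hK.exists_forall_le'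
      (f := fun z => ‖(z.2.2 - z.2.1) - (z.1.2 - z.1.1)‖) (by fun_prop) (a := 0) (by
        rintro ⟨⟨x, x'⟩, ⟨w, w'⟩⟩ ⟨⟨⟨hx, hx'⟩, ⟨hw, hw'⟩⟩, hd'⟩
        refine norm_pos_iff.2 (sub_ne_zero.2 fun h => ?_)
        have := hdeg x hx x' hx' w hw w' hw' h.symm
        simp [this] at hd'
        linarith)
    refine ⟨η, hη0, fun x hx x' hx' w hw w' hw' h => ?_⟩
    by_contra! hd'
    exact (hη ((x, x'), (w, w')) ⟨⟨⟨hx, hx'⟩, ⟨hw, hw'⟩⟩, hd'⟩).not_gt h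
  set ν := (μ.prod μ).map fun z => z.1 - z.2 with hν
  have hνφ : ∀ ξ : V, ‖charFun ν ξ‖ ≤ D ^ 2 * (1 + ‖ξ‖) ^ (-β) := fun ξ => by
    rw [hν, charFun_map_sub_prod, charFun_neg, norm_mul, RCLike.norm_conj]
    calc _ ≤ (D * (1 + ‖ξ‖) ^ (-(β / 2))) * (D * (1 + ‖ξ‖) ^ (-(β / 2))) :=
          mul_le_mul (hφ _) (hφ _) (norm_nonneg _) ((norm_nonneg _).trans (hφ _))
      _ = D ^ 2 * ((1 + ‖ξ‖) ^ (-(β / 2)) * (1 + ‖ξ‖) ^ (-(β / 2))) := by ring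
      _ = _ := by rw [← Real.rpow_add (by positivity)]; ring_nf
  have hνfin : IsFiniteMeasure ν := by rw [hν]; infer_instance
  set m := ((μ.restrict A).prod (μ.restrict B)).map fun z => z.2 - z.1 with hm
  have hmfin : IsFiniteMeasure m := by rw [hm]; infer_instance
  have hm0 : m Set.univ ≠ 0 := by
    rw [hm, Measure.map_apply (by fun_prop) MeasurableSet.univ, Set.preimage_univ,
      ← Set.univ_prod_univ, Measure.prod_prod, Measure.restrict_apply_univ,
      Measure.restrict_apply_univ]
    exact mul_ne_zero hA0 hB0
  have hAB : MeasurableSet (A ×ˢ B) := hAc.measurableSet.prod hBc.measurableSet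
  have hmsupp : m (Metric.closedBall (b - a) (2 * r))ᶜ = 0 := by
    rw [hm, Measure.map_apply (by fun_prop) Metric.isClosed_closedBall.measurableSet.compl,
      Measure.prod_restrict]
    refine (ae_restrict_iff' hAB).2 (Filter.Eventually.of_forall ?_)
    rintro ⟨x, x'⟩ ⟨hx, hx'⟩
    have h1 : ‖x - a‖ ≤ r := mem_closedBall_iff_norm.1 hx.2
    have h2 : ‖x' - b‖ ≤ r := mem_closedBall_iff_norm.1 hx'.2
    refine mem_closedBall_iff_norm.2 ?_
    calc ‖x' - x - (b - a)‖ = ‖(x' - b) - (x - a)‖ := by congr 1; abel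
      _ ≤ ‖x' - b‖ + ‖x - a‖ := norm_sub_le _ _
      _ ≤ 2 * r := by linarith
  have hcomp : ∀ d > (0 : ℝ), ∃ η > (0 : ℝ), ∀ ε ≤ η,
      (m.prod m) {z | ‖z.2 - z.1‖ < ε} ≤ (ν.prod ν) {z | ‖z.2 - z.1‖ < ε ∧ ‖z.1‖ < d} := by
    intro d hd
    obtain ⟨η, hη0, hη⟩ := hsep d hd
    refine ⟨η, hη0, fun ε hε => ?_⟩
    have hs1 : MeasurableSet {z : V × V | ‖z.2 - z.1‖ < ε} :=
      measurableSet_lt (f := fun z : V × V => ‖z.2 - z.1‖) (by fun_prop) measurable_const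
    have hs2 : MeasurableSet {z : V × V | ‖z.2 - z.1‖ < ε ∧ ‖z.1‖ < d} :=
      hs1.inter (measurableSet_lt (f := fun z : V × V => ‖z.1‖) (by fun_prop) measurable_const)
    have hf1 : Measurable fun z : V × V => z.2 - z.1 := by fun_prop
    have hf2 : Measurable fun z : V × V => z.1 - z.2 := by fun_prop
    rw [hm, hν, Measure.map_prod_map _ _ hf1 hf1, Measure.map_prod_map _ _ hf2 hf2,
      Measure.map_apply (hf1.prodMap hf1) hs1, Measure.map_apply (hf2.prodMap hf2) hs2,
      Measure.prod_restrict, Measure.prod_restrict, Measure.restrict_apply (hf1.prodMap hf1 hs1),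
      ← (measurePreserving_prodProdProdComm μ).measure_preimage
        (hf2.prodMap hf2 hs2).nullMeasurableSet]
    refine measure_mono ?_
    rintro ⟨⟨x, x'⟩, ⟨w, w'⟩⟩ ⟨h1, ⟨⟨hx, hx'⟩, ⟨hw, hw'⟩⟩⟩
    have h2 : ‖(w' - w) - (x' - x)‖ < ε := h1
    refine ⟨?_, hη x hx x' hx' w hw w' hw' (h2.trans_le hε)⟩
    change ‖(x' - w') - (x - w)‖ < ε
    rwa [show (x' - w') - (x - w) = -((w' - w) - (x' - x)) by abel, norm_neg]
  set N := finrank ℝ V with hN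
  set ω := volume (Metric.ball (0 : V) 1) with hω
  set Q := volume (Metric.ball (b - a) (2 * r + 1)) with hQ
  have hω0 : ω ≠ 0 := (Metric.measure_ball_pos _ _ one_pos).ne'
  have hωt : ω ≠ ⊤ := measure_ball_lt_top.ne
  have hQ0 : Q ≠ 0 := (Metric.measure_ball_pos _ _ (by positivity)).ne'
  have hQt : Q ≠ ⊤ := measure_ball_lt_top.ne
  set L := m Set.univ ^ 2 * ω with hL
  have hL0 : L ≠ 0 := mul_ne_zero (pow_ne_zero _ hm0) hω0
  have hLt : L ≠ ⊤ := ENNReal.mul_ne_top (ENNReal.pow_ne_top (measure_ne_top _ _)) hωt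
  have hQN0 : Q * 2 ^ N ≠ 0 := mul_ne_zero hQ0 (by simp)
  have hQNt : Q * 2 ^ N ≠ ⊤ := ENNReal.mul_ne_top hQt (by simp)
  obtain ⟨d, hd0, hd⟩ := exists_measure_prod_near_diag_le ν hβ hνφ
    (δ := L / 2 / (Q * 2 ^ N)) (by simp [ENNReal.div_eq_zero_iff, hL0, hQNt])
  obtain ⟨η, hη0, hη⟩ := hcomp d hd0
  obtain ⟨ε, hε0, hε1, hεη⟩ : ∃ ε : ℝ, 0 < ε ∧ ε ≤ 1 ∧ 2 * ε ≤ η :=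
    ⟨min 1 (η / 2), by positivity, min_le_left _ _, by linarith [min_le_right 1 (η / 2)]⟩
  have hεN0 : ENNReal.ofReal (ε ^ N) ≠ 0 := by
    rw [Ne, ENNReal.ofReal_eq_zero, not_le]; positivity
  have hfinal : L * ENNReal.ofReal (ε ^ N) ≤ L / 2 * ENNReal.ofReal (ε ^ N) := by
    calc L * ENNReal.ofReal (ε ^ N) = m Set.univ ^ 2 * volume (Metric.ball (0 : V) ε) := by
          rw [Measure.addHaar_ball _ _ hε0.le, hL]; ring
      _ ≤ Q * (m.prod m) {z | ‖z.2 - z.1‖ < 2 * ε} :=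
          sq_measure_mul_volume_ball_le m hmsupp hε0 hε1
      _ ≤ Q * (L / 2 / (Q * 2 ^ N) * ENNReal.ofReal ((2 * ε) ^ N)) := by
          gcongr
          exact (hη _ hεη).trans (hd _ (by positivity))
      _ = (Q * 2 ^ N) * (L / 2 / (Q * 2 ^ N)) * ENNReal.ofReal (ε ^ N) := by
          rw [mul_pow, ENNReal.ofReal_mul (by positivity), ENNReal.ofReal_pow (by norm_num),
            ENNReal.ofReal_ofNat]
          ring
      _ = _ := by rw [ENNReal.mul_div_cancel hQN0 hQNt]
  rw [ENNReal.mul_le_mul_iff_left hεN0 ENNReal.ofReal_ne_top] at hfinal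
  exact (ENNReal.half_lt_self hL0 hLt).not_ge hfinal

end

theorem charFun_eq_fourierMeasure {n : ℕ} (μ : Measure (EuclideanSpace ℝ (Fin n)))
    (t : EuclideanSpace ℝ (Fin n)) :
    charFun μ t = fourierMeasure μ (-(2 * Real.pi)⁻¹ • t) := by
  rw [charFun_apply, fourierMeasure]
  congr 1 with x
  congr 3
  have h : (2 * Real.pi) ≠ 0 := by positivity
  simp only [PiLp.inner_apply, PiLp.smul_apply, RCLike.inner_apply, conj_trivial, smul_eq_mul]
  rw [Finset.mul_sum, ← Finset.sum_neg_distrib]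
  refine Finset.sum_congr rfl fun i _ => ?_
  field_simp

theorem norm_charFun_le_of_norm_fourierMeasure_le {n : ℕ}
    {μ : Measure (EuclideanSpace ℝ (Fin n))} {C s : ℝ} (hC : 0 ≤ C) (hs : 0 ≤ s)
    (h : ∀ ξ, ‖fourierMeasure μ ξ‖ ≤ C * (1 + ‖ξ‖) ^ (-s)) (t : EuclideanSpace ℝ (Fin n)) :
    ‖charFun μ t‖ ≤ C * (2 * Real.pi) ^ s * (1 + ‖t‖) ^ (-s) := by
  have hπ : 1 ≤ 2 * Real.pi := by linarith [Real.pi_gt_three]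
  rw [charFun_eq_fourierMeasure]
  refine (h _).trans ?_
  rw [mul_assoc]
  refine mul_le_mul_of_nonneg_left ?_ hC
  have h1 : (2 * Real.pi) ^ s = ((2 * Real.pi)⁻¹) ^ (-s) := by
    rw [Real.inv_rpow (by positivity), ← Real.rpow_neg (by positivity), neg_neg]
  rw [h1, ← Real.mul_rpow (by positivity) (by positivity)]
  refine Real.rpow_le_rpow_of_nonpos (by positivity) ?_ (by linarith)
  rw [norm_smul, norm_neg, Real.norm_of_nonneg (by positivity), mul_add, mul_one]
  gcongr
  exact inv_le_one_of_one_le₀ hπ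

theorem measure_singleton_eq_zero_of_ball_le {X : Type*} [PseudoMetricSpace X]
    [MeasurableSpace X] {μ : Measure X} {C α : ℝ} (hα : 0 < α) {x : X}
    (h : ∀ ρ : ℝ, 0 < ρ → ρ < 1 → μ (Metric.ball x ρ) ≤ ENNReal.ofReal (C * ρ ^ α)) :
    μ {x} = 0 := by
  have ht : Filter.Tendsto (fun ρ : ℝ => ENNReal.ofReal (C * ρ ^ α))
      (nhdsWithin 0 (Set.Ioi 0)) (nhds 0) := by
    have h1 : Filter.Tendsto (fun ρ : ℝ => C * ρ ^ α) (nhds 0) (nhds 0) := by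
      have : ContinuousAt (fun ρ : ℝ => C * ρ ^ α) 0 :=
        continuousAt_const.mul (continuousAt_id.rpow_const (Or.inr hα.le))
      simpa [ContinuousAt, Real.zero_rpow hα.ne'] using this
    simpa using (ENNReal.tendsto_ofReal h1).mono_left nhdsWithin_le_nhds
  refine le_antisymm (ge_of_tendsto ht ?_) zero_le
  filter_upwards [Ioo_mem_nhdsGT (one_pos : (0 : ℝ) < 1)] with ρ hρ
  exact (measure_mono (Set.singleton_subset_iff.2 (Metric.mem_ball_self hρ.1))).trans
    (h ρ hρ.1 hρ.2)

theorem statement_3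
    (n : ℕ) (hn : 2 ≤ n)
    (C β : ℝ) (hC : 0 < C) (hβ1 : (n : ℝ) / 2 < β) (hβ2 : β < n) :
    ∃ ε₀ > (0 : ℝ), ∀ α : ℝ, (n : ℝ) - ε₀ < α → α < n →
      ∀ E : Set (EuclideanSpace ℝ (Fin n)), IsClosed E → volume E = 0 →
      ∀ μ : Measure (EuclideanSpace ℝ (Fin n)), IsProbabilityMeasure μ → μ Eᶜ = 0 →
      (∀ x ∈ E, ∀ ρ : ℝ, 0 < ρ → ρ < 1 →
          μ (Metric.ball x ρ) ≤ ENNReal.ofReal (C * ρ ^ α)) →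
      (∀ ξ : EuclideanSpace ℝ (Fin n),
          ‖fourierMeasure μ ξ‖ ≤ C * (1 + ‖ξ‖) ^ (-(β / 2))) →
      ∃ (x y z : EuclideanSpace ℝ (Fin n)),
        y ≠ 0 ∧ z ≠ 0 ∧ y ≠ z ∧ y ≠ -z ∧
        x ∈ E ∧ x + y ∈ E ∧ x + z ∈ E ∧ x + y + z ∈ E := by
  have hn' : (2 : ℝ) ≤ n := by exact_mod_cast hn
  refine ⟨1, one_pos, fun α hα _ E hE _ μ hμ hμE hball hdecay => ?_⟩
  have : Nonempty (Fin n) := ⟨⟨0, by omega⟩⟩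
  have hα0 : 0 < α := by linarith
  exact exists_parallelogram hE μ hμE
    (fun x hx => measure_singleton_eq_zero_of_ball_le hα0 (hball x hx))
    (by simpa using hβ1)
    (norm_charFun_le_of_norm_fourierMeasure_le hC.le (by linarith) hdecay)
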